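/- Suppose the gradient field of the elevation, G : ℝ² → ℝ² (playing the role of ∇E), is Lipschitz continuous with constant L ≥ 0 with respect to the Euclidean norm. Then for every unit vector s ∈ ℝ² (‖s‖₂ = 1), the map x ↦ V(G(x)·s) is Lipschitz continuous with constant 2L, uniformly over all unit vectors s. -/

import Mathlib

open scoped RealInnerProductSpace

/-- The walking velocity function `V(S) = 1.11 exp(-(100S+2)²/2345)`. -/
noncomputable def walkVel (S : ℝ) : ℝ := 1.11 * Real.exp (-(100 * S + 2) ^ 2 / 2345)

theorem hasDerivAt_walkVel (S : ℝ) :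
    HasDerivAt walkVel
      (-(222 / 2345) * ((100 * S + 2) * Real.exp (-(100 * S + 2) ^ 2 / 2345))) S := by
  have h : HasDerivAt (fun S : ℝ => 100 * S + 2) 100 S := by
    simpa using ((hasDerivAt_id S).const_mul 100).add_const 2
  refine ((((h.pow 2).neg.div_const 2345).exp).const_mul 1.11).congr_deriv ?_
  simp only [Pi.pow_apply, Pi.neg_apply]
  push_cast
  ring

/-- The extremal value of `u * exp (-u² / c)`, in squared form. -/
theorem sq_mul_exp_neg_sq_div_le {c : ℝ} (hc : 0 < c) (u : ℝ) :
    (u * Real.exp (-u ^ 2 / c)) ^ 2 ≤ c / 2 * Real.exp (-1) := by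
  have h := Real.add_one_le_exp (2 * u ^ 2 / c - 1)
  have hexp : Real.exp (2 * u ^ 2 / c - 1) * Real.exp (-u ^ 2 / c) ^ 2 = Real.exp (-1) := by
    rw [← Real.exp_nat_mul, ← Real.exp_add]
    congr 1
    push_cast
    ring
  calc (u * Real.exp (-u ^ 2 / c)) ^ 2
      = c / 2 * ((2 * u ^ 2 / c - 1 + 1) * Real.exp (-u ^ 2 / c) ^ 2) := by
        field_simp
        ring
    _ ≤ c / 2 * (Real.exp (2 * u ^ 2 / c - 1) * Real.exp (-u ^ 2 / c) ^ 2) := by gcongr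
    _ = c / 2 * Real.exp (-1) := by rw [hexp]

theorem abs_deriv_walkVel_le (S : ℝ) :
    |-(222 / 2345) * ((100 * S + 2) * Real.exp (-(100 * S + 2) ^ 2 / 2345))| ≤ 2 := by
  apply abs_le_of_sq_le_sq _ (by norm_num)
  have h := sq_mul_exp_neg_sq_div_le (c := 2345) (by norm_num) (100 * S + 2)
  have he : Real.exp (-1) ≤ 1 / 2.7 := by
    rw [Real.exp_neg, ← one_div]
    exact one_div_le_one_div_of_le (by norm_num) (by linarith [Real.exp_one_gt_d9])
  rw [mul_pow]
  linarith

theorem abs_walkVel_sub_le (a b : ℝ) : |walkVel a - walkVel b| ≤ 2 * |a - b| :=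
  convex_univ.norm_image_sub_le_of_norm_hasDerivWithin_le
    (fun S _ => (hasDerivAt_walkVel S).hasDerivWithinAt)
    (fun S _ => abs_deriv_walkVel_le S) (Set.mem_univ b) (Set.mem_univ a)

/-- If the elevation gradient field `G : ℝ² → ℝ²` is Lipschitz with constant
`L ≥ 0` (Euclidean norm), then for every unit vector `s` the map
`x ↦ V(G(x)·s)` is Lipschitz with constant `2L`, uniformly over unit `s`. -/
theorem speed_field_lipschitz
    (G : EuclideanSpace ℝ (Fin 2) → EuclideanSpace ℝ (Fin 2)) (L : ℝ) (hL : 0 ≤ L)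
    (hG : ∀ x y : EuclideanSpace ℝ (Fin 2), ‖G x - G y‖ ≤ L * ‖x - y‖) :
    ∀ s : EuclideanSpace ℝ (Fin 2), ‖s‖ = 1 →
      ∀ x y : EuclideanSpace ℝ (Fin 2),
        |walkVel ⟪G x, s⟫ - walkVel ⟪G y, s⟫| ≤ 2 * L * ‖x - y‖ := by
  intro s hs x y
  calc |walkVel ⟪G x, s⟫ - walkVel ⟪G y, s⟫|
      ≤ 2 * |⟪G x, s⟫ - ⟪G y, s⟫| := abs_walkVel_sub_le _ _
    _ = 2 * |⟪G x - G y, s⟫| := by rw [inner_sub_left]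
    _ ≤ 2 * (‖G x - G y‖ * ‖s‖) := by
        gcongr
        exact abs_real_inner_le_norm _ _
    _ ≤ 2 * (L * ‖x - y‖) := by
        rw [hs, mul_one]
        gcongr
        exact hG x y
    _ = 2 * L * ‖x - y‖ := by ring
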